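/- arXiv:2206.00511 — 2 statements merged into one kernel-verified Lean document; each statement's English description precedes it below -/
import Mathlib

section
/- Let n ≥ 1, let i ∈ Fin n, and let v : Finset (Fin n) → ℝ. For a permutation π of Fin n, let P^π_i = {j ∈ Fin n : π(j) < π(i)} be the set of players preceding i in the order induced by π. Then (1/n!) ∑_{π ∈ Perm(Fin n)} (v(P^π_i ∪ {i}) − v(P^π_i)) = φ_i(v). -/
/-- The Shapley value of player `i` in the game `(N, v)`:
`φ_i(v) = (1/n) ∑_{C ⊆ N \ {i}} C(n−1,|C|)⁻¹ · (v(C ∪ {i}) − v(C))`. -/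
noncomputable def shapley {α : Type*} [DecidableEq α] (N : Finset α) (i : α)
    (v : Finset α → ℝ) : ℝ :=
  (1 / (N.card : ℝ)) * ∑ C ∈ (N.erase i).powerset,
    ((N.card - 1).choose C.card : ℝ)⁻¹ * (v (C ∪ {i}) - v C)

/-- The set of players preceding `i` in the order induced by the permutation `π`. -/
def predSet {n : ℕ} (π : Equiv.Perm (Fin n)) (i : Fin n) : Finset (Fin n) :=
  Finset.univ.filter (fun j => π j < π i)

lemma card_perm_apply_eq {α : Type*} [Fintype α] [DecidableEq α] (a b : α) :
    Fintype.card α * (Finset.univ.filter fun π : Equiv.Perm α => π a = b).card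
      = (Fintype.card α).factorial := by
  have hconst (c : α) : (Finset.univ.filter fun π : Equiv.Perm α => π a = c).card
      = (Finset.univ.filter fun π : Equiv.Perm α => π a = b).card := by
    refine Finset.card_equiv (Equiv.mulLeft (Equiv.swap b c)) fun π => ?_
    simp [Equiv.swap_apply_eq_iff]
  rw [← Fintype.card_perm, ← Finset.card_univ (α := Equiv.Perm α), eq_comm,
    Finset.card_eq_sum_card_fiberwise (f := fun π : Equiv.Perm α => π a) (t := Finset.univ)
      (by simp)]
  simp [hconst]

lemma exists_perm_apply_eq_self_and_map_eq {α : Type*} [Fintype α] [DecidableEq α] {a : α}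
    {s t : Finset α} (hs : a ∉ s) (ht : a ∉ t) (h : s.card = t.card) :
    ∃ σ : Equiv.Perm α, σ a = a ∧ ∀ x, σ x ∈ t ↔ x ∈ s := by
  let e : {x // x ∈ s} ≃ {x // x ∈ t} := Finset.equivOfCardEq h
  have he (x : α) : e.extendSubtype x ∈ t ↔ x ∈ s :=
    ⟨fun hx => by_contra fun hxs => e.extendSubtype_not_mem x hxs hx, e.extendSubtype_mem x⟩
  refine ⟨Equiv.swap (e.extendSubtype a) a * e.extendSubtype, by simp, fun x => ?_⟩
  have ha : e.extendSubtype a ∉ t := by rwa [he]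
  rw [Equiv.Perm.mul_apply, ← he, Equiv.swap_apply_def]
  split_ifs with h₁ h₂
  · simp [h₁, ha, ht]
  · simp [h₂, ha, ht]
  · rfl

lemma mem_predSet {n : ℕ} {π : Equiv.Perm (Fin n)} {i j : Fin n} :
    j ∈ predSet π i ↔ π j < π i := by
  simp [predSet]

lemma card_predSet {n : ℕ} (π : Equiv.Perm (Fin n)) (i : Fin n) :
    (predSet π i).card = π i := by
  rw [← Fin.card_Iio]
  exact Finset.card_equiv π fun j => by simp [mem_predSet]

lemma card_predSet_eq_congr {n : ℕ} {i : Fin n} {C D : Finset (Fin n)} (hC : i ∉ C) (hD : i ∉ D)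
    (h : C.card = D.card) :
    (Finset.univ.filter fun π : Equiv.Perm (Fin n) => predSet π i = C).card
      = (Finset.univ.filter fun π : Equiv.Perm (Fin n) => predSet π i = D).card := by
  obtain ⟨σ, hσ, hσC⟩ := exists_perm_apply_eq_self_and_map_eq hD hC h.symm
  refine Finset.card_equiv (Equiv.mulRight σ) fun π => ?_
  simp only [Finset.mem_filter_univ, Equiv.coe_mulRight, Finset.ext_iff, mem_predSet,
    Equiv.Perm.mul_apply, hσ, ← hσC]
  exact (σ.forall_congr_right (q := fun j => π j < π i ↔ j ∈ C)).symm

lemma card_predSet_eq {n : ℕ} {i : Fin n} {C : Finset (Fin n)} (hC : i ∉ C) :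
    n * ((n - 1).choose C.card *
      (Finset.univ.filter fun π : Equiv.Perm (Fin n) => predSet π i = C).card) = n.factorial := by
  have hlt : C.card < n := by
    simpa using Finset.card_lt_univ_of_notMem hC
  have key := card_perm_apply_eq i (⟨C.card, hlt⟩ : Fin n)
  rw [Fintype.card_fin, Finset.card_eq_sum_card_fiberwise (f := fun π => predSet π i)
    (t := Finset.powersetCard C.card (Finset.univ.erase i))] at key
  · rw [← key, Finset.sum_congr rfl (g := fun _ =>
      (Finset.univ.filter fun π : Equiv.Perm (Fin n) => predSet π i = C).card)]
    · simp
    · intro D hD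
      simp only [Finset.mem_powersetCard, Finset.subset_erase] at hD
      rw [card_predSet_eq_congr hC hD.1.2 hD.2.symm, Finset.filter_filter]
      congr 1
      ext π
      simp only [Finset.mem_filter_univ, and_iff_right_iff_imp, Fin.ext_iff]
      rintro rfl
      rw [← hD.2, card_predSet]
  · intro π hπ
    have hπ : π i = ⟨C.card, hlt⟩ := by simpa using hπ
    simp [Finset.mem_powersetCard, Finset.subset_erase, mem_predSet, card_predSet, hπ]

/-- Permutation form of the Shapley value: averaging the marginal gain of player `i`
over its predecessor sets in uniformly random permutations recovers `φ_i(v)`. -/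
theorem shapley_eq_permutation_average (n : ℕ) (hn : 1 ≤ n) (i : Fin n)
    (v : Finset (Fin n) → ℝ) :
    (1 / (n.factorial : ℝ)) * ∑ π : Equiv.Perm (Fin n),
        (v (predSet π i ∪ {i}) - v (predSet π i))
      = shapley Finset.univ i v := by
  have hmaps : ∀ π ∈ (Finset.univ : Finset (Equiv.Perm (Fin n))),
      predSet π i ∈ (Finset.univ.erase i).powerset := by
    simp [Finset.subset_erase, mem_predSet]
  rw [shapley, ← Finset.sum_fiberwise_of_maps_to' hmaps (fun C => v (C ∪ {i}) - v C),
    Finset.mul_sum, Finset.mul_sum, Finset.card_univ, Fintype.card_fin]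
  refine Finset.sum_congr rfl fun C hC => ?_
  have hC : i ∉ C := by simpa [Finset.subset_erase] using hC
  have hcard := congrArg (Nat.cast (R := ℝ)) (card_predSet_eq hC)
  have hchoose : ((n - 1).choose C.card : ℝ) ≠ 0 := by
    have hlt : C.card < n := by simpa using Finset.card_lt_univ_of_notMem hC
    exact_mod_cast (Nat.choose_pos (by omega)).ne'
  have hn₀ : (n : ℝ) ≠ 0 := by exact_mod_cast (by omega : n ≠ 0)
  have hfact : (n.factorial : ℝ) ≠ 0 := by exact_mod_cast n.factorial_ne_zero
  rw [Finset.sum_const, nsmul_eq_mul]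
  push_cast at hcard
  field_simp
  rw [← hcard]
  ring
end

section
/- Let N be a finite set with |N| = n ≥ 1, let i ∈ N, let v : Finset N → ℝ, and let c ≥ 0. Suppose that |v({i}) − v(∅)| ≤ c and that for every nonempty coalition C ⊆ N \ {i}, |v(C ∪ {i}) − v(C)| ≤ c/|C|. Then |φ_i(v)| ≤ (c/n) · (1 + ∑_{k=1}^{n−1} 1/k). -/
/-- Weighting each subset of `s` by the inverse of the number of subsets of its size turns a sum
of a function of the size into the sum over all sizes. -/
theorem sum_powerset_inv_choose_mul {α : Type*} (s : Finset α) (g : ℕ → ℝ) :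
    ∑ C ∈ s.powerset, (s.card.choose C.card : ℝ)⁻¹ * g C.card =
      ∑ k ∈ Finset.range (s.card + 1), g k := by
  rw [Finset.sum_powerset_apply_card (fun k ↦ (s.card.choose k : ℝ)⁻¹ * g k)]
  refine Finset.sum_congr rfl fun k hk ↦ ?_
  have h : (s.card.choose k : ℝ) ≠ 0 :=
    Nat.cast_ne_zero.mpr (Nat.choose_pos (Finset.mem_range_succ_iff.mp hk)).ne'
  rw [nsmul_eq_mul, mul_inv_cancel_left₀ h]

/-- Diminishing-returns bound on the Shapley value: if the marginal gain of `i` to the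
empty coalition is at most `c` and to any nonempty coalition `C ⊆ N \ {i}` is at most
`c/|C|`, then `|φ_i(v)| ≤ (c/n)(1 + ∑_{k=1}^{n−1} 1/k)`. -/
theorem shapley_le_of_diminishing_returns {α : Type*} [DecidableEq α] (N : Finset α)
    (n : ℕ) (hN : N.card = n) (hn : 1 ≤ n) (i : α) (hi : i ∈ N) (v : Finset α → ℝ)
    (c : ℝ) (hc : 0 ≤ c) (hempty : |v {i} - v ∅| ≤ c)
    (hmarg : ∀ C : Finset α, C ⊆ N.erase i → C.Nonempty →
      |v (C ∪ {i}) - v C| ≤ c / C.card) :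
    |shapley N i v| ≤ c / n * (1 + ∑ k ∈ Finset.Icc 1 (n - 1), 1 / (k : ℝ)) := by
  subst hN
  have hcard : (N.erase i).card = N.card - 1 := Finset.card_erase_of_mem hi
  let g : ℕ → ℝ := fun k ↦ if k = 0 then c else c / k
  have hg : ∀ C ∈ (N.erase i).powerset, |v (C ∪ {i}) - v C| ≤ g C.card := by
    intro C hC
    rcases C.eq_empty_or_nonempty with rfl | hne
    · simpa [g] using hempty
    · simpa [g, hne.ne_empty] using hmarg C (Finset.mem_powerset.mp hC) hne
  have hsum : ∑ k ∈ Finset.range (N.card - 1 + 1), g k =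
      c * (1 + ∑ k ∈ Finset.Icc 1 (N.card - 1), 1 / (k : ℝ)) := by
    rw [Finset.sum_range_succ', Finset.range_eq_Ico,
      Finset.sum_Ico_add' g 0 (N.card - 1) 1, zero_add, Finset.Ico_add_one_right_eq_Icc,
      mul_add, mul_one, Finset.mul_sum, add_comm]
    refine congrArg₂ _ (if_pos rfl) (Finset.sum_congr rfl fun k hk ↦ ?_)
    have hk0 : k ≠ 0 := Nat.one_le_iff_ne_zero.mp (Finset.mem_Icc.mp hk).1
    simp [g, hk0, div_eq_mul_inv]
  rw [shapley, abs_mul, abs_of_nonneg (by positivity), div_mul_eq_mul_div c, ← hsum, ← hcard,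
    ← sum_powerset_inv_choose_mul, one_div, inv_mul_eq_div]
  gcongr
  refine (Finset.abs_sum_le_sum_abs _ _).trans (Finset.sum_le_sum fun C hC ↦ ?_)
  rw [abs_mul, abs_of_nonneg (by positivity)]
  gcongr
  exact hg C hC
end
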